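/- Let t = (t_1,...,t_{d-1}) with t_h ≥ 1 and let u_k = e_{j_1}⋯e_{j_ℓ} (j_1 < ... < j_ℓ) be a minimal generator of a t-spread strongly stable ideal I of E, with the generators ordered lexicographically. Then set_E(u_k) = [m(u_k)] \ ⋃_{h=1}^{ℓ-1}[j_h+1, j_h+t_h-1], and in particular |set_E(u_k)| = m(u_k) - Σ_{h=1}^{ℓ-1}(t_h - 1). -/

import Mathlib

open ExteriorAlgebra

/-- The `i`-th basis monomial `e_i` of the exterior algebra `E = K⟨e_1,…,e_n⟩`. -/
noncomputable def e (K : Type) [Field K] {n : ℕ} (i : Fin n) :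
    ExteriorAlgebra K (Fin n → K) :=
  ι K (Pi.single i 1)

/-- The monomial `e_μ = e_{i_1} ∧ ⋯ ∧ e_{i_d}` for `μ = {i_1 < ⋯ < i_d}`. -/
noncomputable def eMon (K : Type) [Field K] {n : ℕ} (μ : Finset (Fin n)) :
    ExteriorAlgebra K (Fin n → K) :=
  ((μ.sort (· ≤ ·)).map (e K)).prod

/-- The ideal `(u_1, …, u_j)` generated by the monomials `u_i = e_{μ_i}`, `i ≤ j`. -/
noncomputable def Iupto (K : Type) [Field K] {n r : ℕ}
    (μs : Fin r → Finset (Fin n)) (j : Fin r) :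
    Ideal (ExteriorAlgebra K (Fin n → K)) :=
  Ideal.span {v | ∃ i, i ≤ j ∧ v = eMon K (μs i)}

/-- The ideal `(u_1, …, u_{j-1})` generated by the monomials `u_i = e_{μ_i}`, `i < j`. -/
noncomputable def Ibelow (K : Type) [Field K] {n r : ℕ}
    (μs : Fin r → Finset (Fin n)) (j : Fin r) :
    Ideal (ExteriorAlgebra K (Fin n → K)) :=
  Ideal.span {v | ∃ i, i < j ∧ v = eMon K (μs i)}

/-- `set(u_j) = {k : e_k ∈ (u_1,…,u_{j-1}) : (u_j)}`. -/
noncomputable def setIdx (K : Type) [Field K] {n r : ℕ}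
    (μs : Fin r → Finset (Fin n)) (j : Fin r) : Set (Fin n) :=
  {k | e K k * eMon K (μs j) ∈ Ibelow K μs j}

/-- The monomial ideal generated by `u_1, …, u_r` has linear quotients with
respect to this order: each colon ideal `(u_1,…,u_{j-1}) : (u_j)` is generated
by a subset of the variables `e_1, …, e_n`. -/
def LinearQuotients (K : Type) [Field K] {n r : ℕ}
    (μs : Fin r → Finset (Fin n)) : Prop :=
  ∀ j : Fin r, ∃ S : Finset (Fin n),
    {f : ExteriorAlgebra K (Fin n → K) | f * eMon K (μs j) ∈ Ibelow K μs j}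
      = (Ideal.span {v | ∃ k ∈ S, v = e K k} : Set (ExteriorAlgebra K (Fin n → K)))

/-- `g(e_ν) = u_j`: `j` is the least index with `e_ν ∈ (u_1, …, u_j)`. -/
noncomputable def IsDecomp (K : Type) [Field K] {n r : ℕ}
    (μs : Fin r → Finset (Fin n)) (ν : Finset (Fin n)) (j : Fin r) : Prop :=
  eMon K ν ∈ Iupto K μs j ∧ ∀ i, i < j → eMon K ν ∉ Iupto K μs i

/-- `μ = {i_1 < i_2 < ⋯ < i_ℓ}` is `t`-spread if `i_{h+1} - i_h ≥ t_h` for all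
`h = 1, …, ℓ-1` (here `t` is indexed starting from `1`). -/
def TSpread {n : ℕ} (t : ℕ → ℕ) (μ : Finset (Fin n)) : Prop :=
  ∀ (h : ℕ) (hh : h + 1 < (μ.sort (· ≤ ·)).length),
    t (h + 1) ≤ ((μ.sort (· ≤ ·)).get ⟨h + 1, hh⟩ : Fin n).1
        - ((μ.sort (· ≤ ·)).get ⟨h, by omega⟩ : Fin n).1


section helpers

open Finset

lemma e_swap (K : Type) [Field K] {n : ℕ} (i j : Fin n) : e K i * e K j = - (e K j * e K i) := by
  unfold e
  exact eq_neg_of_add_eq_zero_left (ExteriorAlgebra.ι_add_mul_swap _ _)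

lemma e_sq (K : Type) [Field K] {n : ℕ} (i : Fin n) : e K i * e K i = 0 :=
  ExteriorAlgebra.ι_sq_zero _

lemma perm_prod (K : Type) [Field K] {n : ℕ} {l₁ l₂ : List (Fin n)} (h : l₁.Perm l₂) :
    (l₁.map (e K)).prod = (l₂.map (e K)).prod ∨ (l₁.map (e K)).prod = - (l₂.map (e K)).prod := by
  induction h with
  | nil => left; rfl
  | cons x _ ih =>
    rcases ih with ih | ih
    · left; simp [ih]
    · right; simp [ih]
  | swap x y l =>
    right
    simp only [List.map_cons, List.prod_cons, ← mul_assoc]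
    rw [e_swap K y x, neg_mul]
  | trans _ _ ih1 ih2 =>
    rcases ih1 with h1 | h1 <;> rcases ih2 with h2 | h2 <;> simp [h1, h2]

lemma eMon_insert (K : Type) [Field K] {n : ℕ} (i : Fin n) (μ : Finset (Fin n)) (hi : i ∉ μ) :
    eMon K (insert i μ) = e K i * eMon K μ ∨ eMon K (insert i μ) = -(e K i * eMon K μ) := by
  have := perm_prod K (l₁ := (insert i μ).sort (· ≤ ·)) (l₂ := i :: μ.sort (· ≤ ·)) (by
    rw [← Multiset.coe_eq_coe, ← Multiset.cons_coe, Finset.sort_eq, Finset.sort_eq,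
      Finset.insert_val_of_notMem hi])
  simpa [eMon] using this

lemma e_mul_eMon_zero (K : Type) [Field K] {n : ℕ} (i : Fin n) (μ : Finset (Fin n)) (hi : i ∈ μ) :
    e K i * eMon K μ = 0 := by
  have := eMon_insert K i (μ.erase i) (by simp)
  rw [Finset.insert_erase hi] at this
  rcases this with h | h <;> simp [h, ← mul_assoc, e_sq]

lemma insert_mem_iff (K : Type) [Field K] {n : ℕ} (i : Fin n) (μ : Finset (Fin n)) (hi : i ∉ μ)
    (I : Ideal (ExteriorAlgebra K (Fin n → K))) :
    e K i * eMon K μ ∈ I ↔ eMon K (insert i μ) ∈ I := by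
  rcases eMon_insert K i μ hi with h | h
  · rw [h]
  · rw [h, neg_mem_iff]

lemma eMon_mem_of_subset (K : Type) [Field K] {n : ℕ} (μ ν : Finset (Fin n)) (h : μ ⊆ ν)
    (I : Ideal (ExteriorAlgebra K (Fin n → K))) (hI : eMon K μ ∈ I) : eMon K ν ∈ I := by
  have h1 : (ν.sort (· ≤ ·)).Perm ((ν \ μ).sort (· ≤ ·) ++ μ.sort (· ≤ ·)) := by
    rw [← Multiset.coe_eq_coe, ← Multiset.coe_add, Finset.sort_eq, Finset.sort_eq, Finset.sort_eq,
      Finset.sdiff_val, tsub_add_cancel_of_le (Finset.val_le_iff.2 h)]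
  have h2 : eMon K (ν \ μ) * eMon K μ ∈ I := I.mul_mem_left _ hI
  rcases perm_prod K h1 with h | h
  · have : eMon K ν = eMon K (ν \ μ) * eMon K μ := by simpa [eMon] using h
    rwa [this]
  · have : eMon K ν = -(eMon K (ν \ μ) * eMon K μ) := by simpa [eMon] using h
    rw [this]; exact neg_mem h2

lemma eMon_ne_zero (K : Type) [Field K] {n : ℕ} (ν : Finset (Fin n)) : eMon K ν ≠ 0 := by
  intro h0
  let f := ν.orderEmbOfFin rfl
  have h1 : eMon K ν = ExteriorAlgebra.ιMulti K ν.card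
      (fun k => (Pi.single (f k) 1 : Fin n → K)) := by
    rw [ExteriorAlgebra.ιMulti_apply, eMon]
    congr 1
    apply List.ext_getElem
    · simp
    · intro k hk1 hk2
      simp [e, f, Finset.orderEmbOfFin_apply]
  let g : (Fin n → K) [⋀^Fin ν.card]→ₗ[K] K :=
    (Matrix.detRowAlternating (n := Fin ν.card) (R := K)).compLinearMap (LinearMap.funLeft K K f)
  have h2 := ExteriorAlgebra.liftAlternating_apply_ιMulti
    (R := K) (M := Fin n → K) (N := K) (Pi.single ν.card g) (fun k => (Pi.single (f k) 1 : Fin n → K))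
  rw [← h1, h0, map_zero] at h2
  simp only [Pi.single_eq_same] at h2
  have h3 : g (fun k => (Pi.single (f k) 1 : Fin n → K)) = 1 := by
    simp only [g, AlternatingMap.compLinearMap_apply]
    have : (fun i => (LinearMap.funLeft K K f) (Pi.single (f i) 1 : Fin n → K))
       = (1 : Matrix (Fin ν.card) (Fin ν.card) K) := by
      ext i j
      simp [LinearMap.funLeft_apply, Matrix.one_apply, Pi.single_apply, eq_comm]
    rw [this]
    exact Matrix.det_one
  rw [h3] at h2
  exact zero_ne_one h2

lemma eMon_mem_span (K : Type) [Field K] {n : ℕ} (S : Set (Finset (Fin n))) (ν : Finset (Fin n)) :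
    eMon K ν ∈ Ideal.span {v | ∃ μ ∈ S, v = eMon K μ} ↔ ∃ μ ∈ S, μ ⊆ ν := by
  constructor
  · intro h
    by_contra! hc
    let p : (Fin n → K) →ₗ[K] (Fin n → K) :=
      LinearMap.pi (fun i => if i ∈ ν then LinearMap.proj i else 0)
    have hp1 : ∀ i ∈ ν, p (Pi.single i 1) = Pi.single i 1 := by
      intro i hi
      ext j
      by_cases hj : j ∈ ν
      · simp [p, hj]
      · have : j ≠ i := fun h => hj (h ▸ hi)
        simp [p, hj, this]
    have hp2 : ∀ i ∉ ν, p (Pi.single i 1) = 0 := by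
      intro i hi
      ext j
      by_cases hj : j ∈ ν
      · have : j ≠ i := fun h => hi (h ▸ hj)
        simp [p, hj, this]
      · simp [p, hj]
    let F := ExteriorAlgebra.map p
    have hF : ∀ i, F (e K i) = ExteriorAlgebra.ι K (p (Pi.single i 1)) := by
      intro i; simp [F, e]
    have hle : Ideal.span {v | ∃ μ ∈ S, v = eMon K μ} ≤ RingHom.ker F := by
      rw [Ideal.span_le]
      rintro v ⟨μ, hμ, rfl⟩
      obtain ⟨i, hi, hin⟩ := Finset.not_subset.1 (hc μ hμ)
      simp only [SetLike.mem_coe, RingHom.mem_ker, eMon, map_list_prod, List.map_map]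
      rw [List.prod_eq_zero]
      rw [List.mem_map]
      exact ⟨i, by simpa using hi, by simp [hF, hp2 i hin]⟩
    have h1 := hle h
    rw [RingHom.mem_ker] at h1
    apply eMon_ne_zero K ν
    rw [← h1]
    simp only [eMon, map_list_prod, List.map_map]
    congr 1
    apply List.map_congr_left
    intro i hi
    simp only [Function.comp, hF, hp1 i (by simpa using hi)]
    rfl
  · rintro ⟨μ, hμ, hs⟩
    exact eMon_mem_of_subset K μ ν hs _ (Ideal.subset_span ⟨μ, hμ, rfl⟩)

/-- number of elements of `μ` up to `x` -/
def cnt {n : ℕ} (μ : Finset (Fin n)) (x : Fin n) : ℕ := (μ.filter (· ≤ x)).card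

lemma get_strictMono {n : ℕ} (μ : Finset (Fin n)) (a b : ℕ) (ha : a < (μ.sort (· ≤ ·)).length)
    (hb : b < (μ.sort (· ≤ ·)).length) :
    (μ.sort (· ≤ ·)).get ⟨a, ha⟩ < (μ.sort (· ≤ ·)).get ⟨b, hb⟩ ↔ a < b := by
  have h : StrictMono (μ.sort (· ≤ ·)).get := (Finset.sortedLT_sort μ).strictMono_get
  rw [h.lt_iff_lt]; simp

lemma get_mem {n : ℕ} (μ : Finset (Fin n)) (a : ℕ) (ha : a < (μ.sort (· ≤ ·)).length) :
    (μ.sort (· ≤ ·)).get ⟨a, ha⟩ ∈ μ := by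
  rw [← Finset.mem_sort (· ≤ ·)]
  exact List.get_mem _ _

lemma exists_get {n : ℕ} (μ : Finset (Fin n)) (x : Fin n) (hx : x ∈ μ) :
    ∃ (a : ℕ) (ha : a < (μ.sort (· ≤ ·)).length), (μ.sort (· ≤ ·)).get ⟨a, ha⟩ = x := by
  rw [← Finset.mem_sort (· ≤ ·)] at hx
  obtain ⟨a, ha⟩ := List.get_of_mem hx
  exact ⟨a.1, a.2, ha⟩

lemma cnt_get {n : ℕ} (μ : Finset (Fin n)) (a : ℕ) (ha : a < (μ.sort (· ≤ ·)).length) :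
    cnt μ ((μ.sort (· ≤ ·)).get ⟨a, ha⟩) = a + 1 := by
  unfold cnt
  have h : StrictMono (μ.sort (· ≤ ·)).get := (Finset.sortedLT_sort μ).strictMono_get
  have : μ.filter (· ≤ (μ.sort (· ≤ ·)).get ⟨a, ha⟩)
      = (Finset.Iic (⟨a, ha⟩ : Fin (μ.sort (· ≤ ·)).length)).map ⟨_, h.injective⟩ := by
    ext x
    simp only [Finset.mem_filter, Finset.mem_map, Finset.mem_Iic, Function.Embedding.coeFn_mk]
    constructor
    · rintro ⟨hx, hle⟩
      obtain ⟨b, hb, rfl⟩ := exists_get μ x hx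
      exact ⟨⟨b, hb⟩, h.le_iff_le.1 hle, rfl⟩
    · rintro ⟨b, hb, rfl⟩
      exact ⟨get_mem μ _ _, h.le_iff_le.2 hb⟩
  rw [this, Finset.card_map, Fin.card_Iic]

lemma tspread_iff {n : ℕ} (t : ℕ → ℕ) (ht : ∀ h, 1 ≤ t h) (μ : Finset (Fin n)) :
    TSpread t μ ↔ ∀ x ∈ μ, ∀ y ∈ μ, x < y → x.1 + t (cnt μ x) ≤ y.1 := by
  constructor
  · intro h x hx y hy hxy
    obtain ⟨a, ha, rfl⟩ := exists_get μ x hx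
    obtain ⟨b, hb, rfl⟩ := exists_get μ y hy
    rw [cnt_get]
    rw [get_strictMono] at hxy
    have h1 := h a (by omega)
    have h2 : (μ.sort (· ≤ ·)).get ⟨a + 1, by omega⟩ ≤ (μ.sort (· ≤ ·)).get ⟨b, hb⟩ := by
      rw [← not_lt, get_strictMono]; omega
    have h3 := ht (a + 1)
    rw [Fin.le_def] at h2
    omega
  · intro h a ha
    have := h _ (get_mem μ a (by omega)) _ (get_mem μ (a+1) ha) (by rw [get_strictMono]; omega)
    rw [cnt_get] at this
    omega

lemma cnt_congr {n : ℕ} (μ ν : Finset (Fin n)) (x : Fin n) (h : ∀ z ≤ x, z ∈ μ ↔ z ∈ ν) :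
    cnt μ x = cnt ν x := by
  unfold cnt
  congr 1
  ext z
  simp only [Finset.mem_filter]
  constructor
  · rintro ⟨h1, h2⟩; exact ⟨(h z h2).1 h1, h2⟩
  · rintro ⟨h1, h2⟩; exact ⟨(h z h2).2 h1, h2⟩

lemma cnt_exchange {n : ℕ} (μ : Finset (Fin n)) (a b x : Fin n)
    (ha : a ∉ μ) (hb : b ∈ μ) (hab : a < b) (hx : b ≤ x) :
    cnt (insert a (μ.erase b)) x = cnt μ x := by
  unfold cnt
  rw [Finset.filter_insert, if_pos (hab.le.trans hx), Finset.card_insert_of_notMem (by simp [ha]),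
    Finset.filter_erase, Finset.card_erase_of_mem (by simp [hb, hx])]
  have : 0 < (μ.filter (· ≤ x)).card := Finset.card_pos.2 ⟨b, by simp [hb, hx]⟩
  omega

lemma exchange {n : ℕ} (t : ℕ → ℕ) (μ : Finset (Fin n))
    (h : ∀ x ∈ μ, ∀ y ∈ μ, x < y → x.1 + t (cnt μ x) ≤ y.1) (a b : Fin n)
    (ha : a ∉ μ) (hb : b ∈ μ) (hab : a < b) (hno : ∀ z ∈ μ, a < z → b ≤ z)
    (hlow : ∀ x ∈ μ, x < a → x.1 + t (cnt μ x) ≤ a.1) :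
    ∀ x ∈ insert a (μ.erase b), ∀ y ∈ insert a (μ.erase b), x < y →
      x.1 + t (cnt (insert a (μ.erase b)) x) ≤ y.1 := by
  have hc1 : ∀ x, x < a → cnt (insert a (μ.erase b)) x = cnt μ x := by
    intro x hx
    apply cnt_congr
    intro z hz
    have : z ≠ a := by rintro rfl; exact absurd hx (not_lt.2 hz)
    have : z ≠ b := by rintro rfl; exact absurd (hz.trans_lt hx) (not_lt.2 hab.le)
    simp [*]
  have hc2 : cnt (insert a (μ.erase b)) a = cnt μ b := by
    rw [← cnt_exchange μ a b b ha hb hab le_rfl]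
    unfold cnt
    congr 1
    ext z
    simp only [Finset.mem_filter, Finset.mem_insert, Finset.mem_erase]
    constructor
    · rintro ⟨h1, h2⟩; exact ⟨h1, h2.trans hab.le⟩
    · rintro ⟨h1, h2⟩
      refine ⟨h1, ?_⟩
      rcases h1 with rfl | ⟨h1, h3⟩
      · exact le_rfl
      · by_contra hz
        exact h1 (le_antisymm h2 (hno z h3 (not_le.1 hz)))
  intro x hx y hy hxy
  simp only [Finset.mem_insert, Finset.mem_erase] at hx hy
  rcases hx with rfl | ⟨hxb, hx⟩
  · rcases hy with rfl | ⟨hyb, hy⟩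
    · exact absurd hxy (lt_irrefl _)
    · rw [hc2]
      have := h b hb y hy (lt_of_le_of_ne (hno y hy hxy) (Ne.symm hyb))
      rw [Fin.lt_def] at hab
      omega
  · rcases lt_or_ge x a with hxa | hxa
    · rw [hc1 x hxa]
      rcases hy with rfl | ⟨hyb, hy⟩
      · exact hlow x hx hxa
      · exact h x hx y hy hxy
    · have hxa' : a < x := lt_of_le_of_ne hxa (by rintro rfl; exact ha hx)
      rw [cnt_exchange μ a b x ha hb hab (hno x hx hxa')]
      rcases hy with rfl | ⟨hyb, hy⟩
      · exact absurd hxy (not_lt.2 hxa)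
      · exact h x hx y hy hxy

/-- combinatorial core -/
lemma core {n r : ℕ} (t : ℕ → ℕ)
    (μs : Fin r → Finset (Fin n))
    (hne : ∀ i, (μs i).Nonempty)
    (hmin : ∀ i j, i ≠ j → ¬ μs i ⊆ μs j)
    (hts : ∀ i, ∀ x ∈ μs i, ∀ y ∈ μs i, x < y → x.1 + t (cnt (μs i) x) ≤ y.1)
    (hlex : ∀ i j : Fin r, i < j → μs i ≠ μs j ∧
      ∀ hd : (symmDiff (μs i) (μs j)).Nonempty,
        (symmDiff (μs i) (μs j)).min' hd ∈ μs i)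
    (hss : ∀ p : Fin r, ∀ b ∈ μs p, ∀ a : Fin n, a < b → a ∉ μs p →
      (∀ z ∈ μs p, a < z → b ≤ z) →
      (∀ x ∈ μs p, x < a → x.1 + t (cnt (μs p) x) ≤ a.1) →
      ∃ q, μs q ⊆ insert a ((μs p).erase b))
    (k : Fin r) (i : Fin n) (hi : i ∉ μs k) :
    (∃ p, p < k ∧ μs p ⊆ insert i (μs k)) ↔
      (i ≤ (μs k).max' (hne k) ∧ ∀ x ∈ μs k, x < i → x.1 + t (cnt (μs k) x) ≤ i.1) := by
  constructor
  · rintro ⟨p, hpk, hsub⟩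
    have hip : i ∈ μs p := by
      by_contra hip
      apply hmin p k hpk.ne
      intro z hz
      rcases Finset.mem_insert.1 (hsub hz) with rfl | h
      · exact absurd hz hip
      · exact h
    have hid : i ∈ symmDiff (μs p) (μs k) := by simp [Finset.mem_symmDiff, hip, hi]
    have hmn := (hlex p k hpk).2 ⟨i, hid⟩
    set m := (symmDiff (μs p) (μs k)).min' ⟨i, hid⟩ with hm
    have hmm : m ∈ symmDiff (μs p) (μs k) := Finset.min'_mem _ _
    have hmi : m = i := by
      rcases Finset.mem_insert.1 (hsub hmn) with h | h
      · exact h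
      · simp [Finset.mem_symmDiff, hmn, h] at hmm
    have hlt : ∀ z ∈ symmDiff (μs p) (μs k), i ≤ z := by
      intro z hz
      rw [← hmi]
      exact Finset.min'_le _ _ hz
    constructor
    · obtain ⟨z, hz, hzp⟩ := Finset.not_subset.1 (hmin k p hpk.ne')
      exact (hlt z (by simp [Finset.mem_symmDiff, hz, hzp])).trans (Finset.le_max' _ _ hz)
    · intro x hx hxi
      have heq : ∀ z ≤ x, (z ∈ μs p ↔ z ∈ μs k) := by
        intro z hz
        by_contra hc
        have : z ∈ symmDiff (μs p) (μs k) := by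
          rw [Finset.mem_symmDiff]; tauto
        exact absurd (hlt z this) (not_le.2 (hz.trans_lt hxi))
      rw [← cnt_congr _ _ x heq]
      exact hts p x ((heq x le_rfl).2 hx) i hip hxi
  · rintro ⟨hle, hlow⟩
    have hlt : i < (μs k).max' (hne k) :=
      lt_of_le_of_ne hle (by intro h; exact hi (h ▸ Finset.max'_mem _ _))
    have hU : ((μs k).filter (i < ·)).Nonempty :=
      ⟨_, Finset.mem_filter.2 ⟨Finset.max'_mem _ (hne k), hlt⟩⟩
    obtain ⟨b, hb, hbmin⟩ : ∃ b ∈ (μs k).filter (i < ·), ∀ z ∈ (μs k).filter (i < ·), b ≤ z :=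
      ⟨_, Finset.min'_mem _ hU, fun z hz => Finset.min'_le _ _ hz⟩
    rw [Finset.mem_filter] at hb
    obtain ⟨hbk, hib⟩ := hb
    have hno : ∀ z ∈ μs k, i < z → b ≤ z := fun z hz h => hbmin z (Finset.mem_filter.2 ⟨hz, h⟩)
    have hw := exchange t (μs k) (hts k) i b hi hbk hib hno hlow
    set w := insert i ((μs k).erase b) with hwdef
    obtain ⟨q0, hq0⟩ := hss k b hbk i hib hi hno hlow
    obtain ⟨p, hp, hpmin⟩ := Finset.exists_min_image
      ((Finset.univ : Finset (Fin r)).filter (fun q => μs q ⊆ w))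
      (fun q => ∑ x ∈ μs q, (x.1 + 1)) ⟨q0, by simpa using hq0⟩
    have hpw : μs p ⊆ w := by simpa using hp
    have hbw : b ∉ w := by simp [hwdef, hib.ne']
    have hpk : p ≠ k := by rintro rfl; exact hbw (hpw hbk)
    have hwi : w ⊆ insert i (μs k) := Finset.insert_subset_insert _ (Finset.erase_subset _ _)
    have hpi : μs p ⊆ insert i (μs k) := hpw.trans hwi
    refine ⟨p, ?_, hpi⟩
    have hip : i ∈ μs p := by
      by_contra hip
      apply hmin p k hpk
      intro z hz
      rcases Finset.mem_insert.1 (hpi hz) with rfl | h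
      · exact absurd hz hip
      · exact h
    by_contra hnlt
    have hkp : k < p := lt_of_le_of_ne (not_lt.1 hnlt) (Ne.symm hpk)
    have hid : i ∈ symmDiff (μs k) (μs p) := by simp [Finset.mem_symmDiff, hip, hi]
    have hmn := (hlex k p hkp).2 ⟨i, hid⟩
    have hmm := Finset.min'_mem (symmDiff (μs k) (μs p)) ⟨i, hid⟩
    have hmi := Finset.min'_le (symmDiff (μs k) (μs p)) i hid
    set m := (symmDiff (μs k) (μs p)).min' ⟨i, hid⟩ with hm
    have hmp : m ∉ μs p := by
      intro h; simp [Finset.mem_symmDiff, hmn, h] at hmm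
    have hmlt : m < i := lt_of_le_of_ne hmi (by intro h; exact hi (h ▸ hmn))
    have hmw : m ∈ w := by
      simp [hwdef, hmn, (hmlt.trans hib).ne]
    -- the least missing element
    obtain ⟨a, ha, hamin⟩ : ∃ a ∈ w \ μs p, ∀ z ∈ w \ μs p, a ≤ z :=
      ⟨_, Finset.min'_mem _ ⟨m, by simp [hmw, hmp]⟩, fun z hz => Finset.min'_le _ _ hz⟩
    rw [Finset.mem_sdiff] at ha
    have hai : a < i := (hamin m (by simp [hmw, hmp])).trans_lt hmlt
    obtain ⟨c, hc, hcmin⟩ : ∃ c ∈ (μs p).filter (a < ·), ∀ z ∈ (μs p).filter (a < ·), c ≤ z :=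
      ⟨_, Finset.min'_mem _ ⟨i, by simp [hip, hai]⟩, fun z hz => Finset.min'_le _ _ hz⟩
    rw [Finset.mem_filter] at hc
    obtain ⟨q, hq⟩ := hss p c hc.1 a hc.2 ha.2
      (fun z hz h => hcmin z (Finset.mem_filter.2 ⟨hz, h⟩)) (by
        intro x hx hxa
        have heq : ∀ z ≤ x, (z ∈ μs p ↔ z ∈ w) := by
          intro z hz
          refine ⟨fun h => hpw h, fun h => ?_⟩
          by_contra hzp
          exact absurd (hamin z (Finset.mem_sdiff.2 ⟨h, hzp⟩)) (not_le.2 (hz.trans_lt hxa))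
        rw [cnt_congr _ _ x heq]
        exact hw x (hpw hx) a ha.1 hxa)
    have hqw : μs q ⊆ w := hq.trans (Finset.insert_subset ha.1 ((Finset.erase_subset _ _).trans hpw))
    have h1 := hpmin q (by simpa using hqw)
    have h2 : ∑ x ∈ μs q, (x.1 + 1) ≤ ∑ x ∈ insert a ((μs p).erase c), (x.1 + 1) :=
      Finset.sum_le_sum_of_subset hq
    rw [Finset.sum_insert (by simp [ha.2])] at h2
    have h3 := Finset.add_sum_erase (μs p) (fun x => x.1 + 1) hc.1
    have h4 := hc.2
    rw [Fin.lt_def] at h4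
    omega

lemma card_part {n : ℕ} (t : ℕ → ℕ) (ht : ∀ h, 1 ≤ t h) (μ : Finset (Fin n)) (hne : μ.Nonempty)
    (hts : TSpread t μ) :
    ({i : Fin n | i ≤ μ.max' hne ∧
          ∀ (h : ℕ) (hh : h + 1 < (μ.sort (· ≤ ·)).length),
            ¬ (((μ.sort (· ≤ ·)).get ⟨h, by omega⟩ : Fin n).1 + 1 ≤ i.1 ∧
              i.1 ≤ ((μ.sort (· ≤ ·)).get ⟨h, by omega⟩ : Fin n).1 + t (h + 1) - 1)}).ncard
      = (μ.max' hne).1 + 1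
          - ∑ h ∈ Finset.range ((μ.sort (· ≤ ·)).length - 1), (t (h + 1) - 1) := by
  classical
  set L := μ.sort (· ≤ ·) with hL
  let g : ℕ → ℕ := fun h => if hh : h < L.length then (L.get ⟨h, hh⟩).1 else 0
  have hg : ∀ h (hh : h < L.length), (L.get ⟨h, hh⟩).1 = g h := by
    intro h hh; simp [g, hh]
  have hgap : ∀ a b, a < b → b < L.length → g a + t (a + 1) ≤ g b := by
    intro a b hab hb
    have := (tspread_iff t ht μ).1 hts _ (get_mem μ a (hab.trans hb)) _ (get_mem μ b hb)
      ((get_strictMono μ _ _ _ _).2 hab)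
    rw [cnt_get] at this
    rw [← hg a (hab.trans hb), ← hg b hb]
    exact this
  have hgm : ∀ a, a < L.length → g a ≤ (μ.max' hne).1 := by
    intro a ha
    rw [← hg a ha]
    exact Finset.le_max' _ _ (get_mem μ a ha)
  let B := (Finset.range (L.length - 1)).biUnion (fun h => Finset.Icc (g h + 1) (g h + t (h+1) - 1))
  have hB : B.card = ∑ h ∈ Finset.range (L.length - 1), (t (h + 1) - 1) := by
    rw [Finset.card_biUnion]
    · apply Finset.sum_congr rfl
      intro h _
      have := ht (h+1)
      rw [Nat.card_Icc]; omega
    · intro a ha b hb hab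
      rw [Finset.mem_coe, Finset.mem_range] at ha hb
      rw [Function.onFun, Finset.disjoint_left]
      intro z hz1 hz2
      rw [Finset.mem_Icc] at hz1 hz2
      rcases lt_or_gt_of_ne hab with h | h
      · have := hgap a b h (by omega)
        omega
      · have := hgap b a h (by omega)
        omega
  have hBs : B ⊆ Finset.range ((μ.max' hne).1 + 1) := by
    intro z hz
    simp only [B, Finset.mem_biUnion, Finset.mem_range, Finset.mem_Icc] at hz ⊢
    obtain ⟨a, ha, h1, h2⟩ := hz
    have := hgap a (a+1) (by omega) (by omega)
    have := hgm (a+1) (by omega)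
    omega
  rw [← hB, ← Set.ncard_image_of_injective _ Fin.val_injective]
  have : (Fin.val '' {i : Fin n | i ≤ μ.max' hne ∧
          ∀ (h : ℕ) (hh : h + 1 < L.length),
            ¬ ((L.get ⟨h, by omega⟩ : Fin n).1 + 1 ≤ i.1 ∧
              i.1 ≤ (L.get ⟨h, by omega⟩ : Fin n).1 + t (h + 1) - 1)})
      = ((Finset.range ((μ.max' hne).1 + 1) \ B : Finset ℕ) : Set ℕ) := by
    ext z
    simp only [Set.mem_image, Set.mem_setOf_eq, Finset.mem_coe, Finset.mem_sdiff, Finset.mem_range,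
      B, Finset.mem_biUnion, Finset.mem_Icc]
    constructor
    · rintro ⟨i, ⟨h1, h2⟩, rfl⟩
      refine ⟨Nat.lt_succ_of_le h1, ?_⟩
      rintro ⟨a, ha, h3⟩
      apply h2 a (by omega)
      rw [hg]
      exact h3
    · rintro ⟨h1, h2⟩
      refine ⟨⟨z, by have := (μ.max' hne).2; omega⟩, ⟨?_, ?_⟩, rfl⟩
      · rw [Fin.le_def]; exact Nat.le_of_lt_succ h1
      · intro h hh hc
        rw [hg] at hc
        exact h2 ⟨h, by omega, hc⟩
  rw [this, Set.ncard_coe_finset, Finset.card_sdiff_of_subset hBs, Finset.card_range]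

end helpers

/-- Let `t = (t_1, t_2, …)` with all `t_h ≥ 1` and let `I` be a `t`-spread
strongly stable ideal of `E` whose minimal generators `u_1, …, u_r` are listed
in the (decreasing) lexicographic order. Write `u_k = e_{j_1}⋯e_{j_ℓ}` with
`j_1 < ⋯ < j_ℓ`. Then
`set_E(u_k) = [m(u_k)] \ ⋃_{h=1}^{ℓ-1} [j_h + 1, j_h + t_h - 1]`, and in
particular `|set_E(u_k)| = m(u_k) - Σ_{h=1}^{ℓ-1} (t_h - 1)` (indices here are
`0`-based, so the paper's `m(u_k)` is `max(μ_k) + 1`). -/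
theorem stmt19 {K : Type} [Field K] {n r : ℕ} (t : ℕ → ℕ)
    (ht : ∀ h, 1 ≤ t h)
    (μs : Fin r → Finset (Fin n))
    (hne : ∀ i, (μs i).Nonempty)
    (hmin : ∀ i j, i ≠ j → ¬ μs i ⊆ μs j)
    (hts : ∀ i, TSpread t (μs i))
    -- the generators are listed in decreasing lexicographic order
    (hlex : ∀ i j : Fin r, i < j → μs i ≠ μs j ∧
      ∀ hd : (symmDiff (μs i) (μs j)).Nonempty,
        (symmDiff (μs i) (μs j)).min' hd ∈ μs i)
    -- `I = (u_1, …, u_r)` is `t`-spread strongly stable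
    (hss : ∀ ν : Finset (Fin n), TSpread t ν →
      eMon K ν ∈ Ideal.span {v | ∃ i : Fin r, v = eMon K (μs i)} →
      ∀ j ∈ ν, ∀ i : Fin n, i < j → i ∉ ν.erase j →
        TSpread t (insert i (ν.erase j)) →
        e K i * eMon K (ν.erase j)
          ∈ Ideal.span {v | ∃ i' : Fin r, v = eMon K (μs i')})
    (k : Fin r) :
    setIdx K μs k
      = {i : Fin n | i ≤ (μs k).max' (hne k) ∧
          ∀ (h : ℕ) (hh : h + 1 < ((μs k).sort (· ≤ ·)).length),
            ¬ ((((μs k).sort (· ≤ ·)).get ⟨h, by omega⟩ : Fin n).1 + 1 ≤ i.1 ∧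
              i.1 ≤ (((μs k).sort (· ≤ ·)).get ⟨h, by omega⟩ : Fin n).1 + t (h + 1) - 1)} ∧
    (setIdx K μs k).ncard
      = ((μs k).max' (hne k)).1 + 1
          - ∑ h ∈ Finset.range (((μs k).sort (· ≤ ·)).length - 1), (t (h + 1) - 1) := by
  have hspan : ∀ (P : Fin r → Prop) (ν : Finset (Fin n)),
      eMon K ν ∈ Ideal.span {v | ∃ i, P i ∧ v = eMon K (μs i)} ↔ ∃ i, P i ∧ μs i ⊆ ν := by
    intro P ν
    have h := eMon_mem_span K {μ | ∃ i, P i ∧ μ = μs i} ν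
    have h1 : {v | ∃ μ ∈ {μ | ∃ i, P i ∧ μ = μs i}, v = eMon K μ}
        = {v | ∃ i, P i ∧ v = eMon K (μs i)} := by
      ext v
      constructor
      · rintro ⟨_, ⟨i, hi, rfl⟩, rfl⟩; exact ⟨i, hi, rfl⟩
      · rintro ⟨i, hi, rfl⟩; exact ⟨_, ⟨i, hi, rfl⟩, rfl⟩
    rw [h1] at h
    rw [h]
    constructor
    · rintro ⟨_, ⟨i, hi, rfl⟩, hs⟩; exact ⟨i, hi, hs⟩
    · rintro ⟨i, hi, hs⟩; exact ⟨_, ⟨i, hi, rfl⟩, hs⟩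
  have hts' := fun i => (tspread_iff t ht (μs i)).1 (hts i)
  have hss' : ∀ p : Fin r, ∀ b ∈ μs p, ∀ a : Fin n, a < b → a ∉ μs p →
      (∀ z ∈ μs p, a < z → b ≤ z) →
      (∀ x ∈ μs p, x < a → x.1 + t (cnt (μs p) x) ≤ a.1) →
      ∃ q, μs q ⊆ insert a ((μs p).erase b) := by
    intro p b hb a hab ha hno hlow
    have hae : a ∉ (μs p).erase b := by simp [ha]
    have h1 := hss (μs p) (hts p) (Ideal.subset_span ⟨p, rfl⟩) b hb a hab hae
      ((tspread_iff t ht _).2 (exchange t (μs p) (hts' p) a b ha hb hab hno hlow))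
    rw [insert_mem_iff K a _ hae] at h1
    have h2 := hspan (fun _ => True) (insert a ((μs p).erase b))
    simp only [true_and] at h2
    exact h2.1 h1
  have hset : setIdx K μs k
      = {i : Fin n | i ≤ (μs k).max' (hne k) ∧
          ∀ (h : ℕ) (hh : h + 1 < ((μs k).sort (· ≤ ·)).length),
            ¬ ((((μs k).sort (· ≤ ·)).get ⟨h, by omega⟩ : Fin n).1 + 1 ≤ i.1 ∧
              i.1 ≤ (((μs k).sort (· ≤ ·)).get ⟨h, by omega⟩ : Fin n).1 + t (h + 1) - 1)} := by
    ext i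
    have hR : i ∈ {i : Fin n | i ≤ (μs k).max' (hne k) ∧
          ∀ (h : ℕ) (hh : h + 1 < ((μs k).sort (· ≤ ·)).length),
            ¬ ((((μs k).sort (· ≤ ·)).get ⟨h, by omega⟩ : Fin n).1 + 1 ≤ i.1 ∧
              i.1 ≤ (((μs k).sort (· ≤ ·)).get ⟨h, by omega⟩ : Fin n).1 + t (h + 1) - 1)} ↔
        (i ≤ (μs k).max' (hne k) ∧ ∀ x ∈ μs k, x < i → x.1 + t (cnt (μs k) x) ≤ i.1) := by
      rw [Set.mem_setOf_eq]
      refine and_congr_right (fun hle => ?_)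
      constructor
      · intro h x hx hxi
        obtain ⟨a, ha, rfl⟩ := exists_get _ x hx
        rw [cnt_get]
        have hlt := hxi.trans_le hle
        obtain ⟨c, hc, hcm⟩ := exists_get _ _ (Finset.max'_mem _ (hne k))
        rw [← hcm, get_strictMono] at hlt
        have h1 := h a (by omega)
        rw [Fin.lt_def] at hxi
        omega
      · intro h a ha hc
        have h1 := h _ (get_mem (μs k) a (by omega)) (by rw [Fin.lt_def]; omega)
        rw [cnt_get] at h1
        have := ht (a + 1)
        omega
    rw [hR]
    unfold setIdx Ibelow
    rw [Set.mem_setOf_eq]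
    by_cases hi : i ∈ μs k
    · rw [e_mul_eMon_zero K i _ hi]
      refine iff_of_true (zero_mem _) ⟨Finset.le_max' _ _ hi, fun x hx hxi => hts' k x hx i hi hxi⟩
    · rw [insert_mem_iff K i _ hi, hspan]
      exact core t μs hne hmin hts' hlex hss' k i hi
  refine ⟨hset, ?_⟩
  rw [hset]
  exact card_part t ht (μs k) (hne k) (hts k)
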